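/- Let F : 𝔽₂^{n×2} → ℝ and K = (κ_i)_{i=1}^n ∈ 𝔽₂^{n×2}∖{0} with rows κ_i. Then for every 1 ≤ w ≤ v(K)−1, R_w F̂(K) = −(1/4)·wal_{κ_w}(σ(κ_w))·R_w (d_K^{(w)} d_K^{(v(K))} F)^(K). -/

import Mathlib

open MeasureTheory

noncomputable section

/-- The two-element field. -/
abbrev F2 : Type := ZMod 2

/-- Points of the plane. -/
abbrev Pt : Type := EuclideanSpace ℝ (Fin 2)

/-- The (closed) triangle with vertices `A`, `B`, `C`. -/
def tri (A B C : Pt) : Set Pt :=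
  {x | ∃ w1 w2 w3 : ℝ, 0 ≤ w1 ∧ 0 ≤ w2 ∧ 0 ≤ w3 ∧ w1 + w2 + w3 = 1 ∧
    x = w1 • A + w2 • B + w3 • C}

/-- One step of the recursive partitioning, acting on vertex triples `(A,B,C)`. -/
def subV (v : Pt × Pt × Pt) (ξ : F2 × F2) : Pt × Pt × Pt :=
  if ξ = (1, 0) then (v.1, (2:ℝ)⁻¹ • (v.1 + v.2.1), (2:ℝ)⁻¹ • (v.1 + v.2.2))
  else if ξ = (0, 1) then ((2:ℝ)⁻¹ • (v.2.1 + v.1), v.2.1, (2:ℝ)⁻¹ • (v.2.1 + v.2.2))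
  else if ξ = (1, 1) then ((2:ℝ)⁻¹ • (v.2.2 + v.1), (2:ℝ)⁻¹ • (v.2.2 + v.2.1), v.2.2)
  else ((2:ℝ)⁻¹ • (v.2.1 + v.2.2), (2:ℝ)⁻¹ • (v.2.2 + v.1), (2:ℝ)⁻¹ • (v.1 + v.2.1))

/-- Iterated partitioning along a list of pairs of bits (the rows of `X`). -/
def vIter (v : Pt × Pt × Pt) (l : List (F2 × F2)) : Pt × Pt × Pt := l.foldl subV v

/-- The subtriangle `T^{(n)}(X)` where `l` is the list of rows of `X`. -/
def subTri (v : Pt × Pt × Pt) (l : List (F2 × F2)) : Set Pt :=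
  tri (vIter v l).1 (vIter v l).2.1 (vIter v l).2.2

/-- The centre `φ^{(n)}(X)` of the subtriangle `T^{(n)}(X)`. -/
def ctr (v : Pt × Pt × Pt) (l : List (F2 × F2)) : Pt :=
  (3:ℝ)⁻¹ • ((vIter v l).1 + (vIter v l).2.1 + (vIter v l).2.2)

/-- The sign `η_i(X)` (with `i` 1-indexed, `1 ≤ i ≤ n+1`). -/
def eta {n : ℕ} (X : Fin n → F2 × F2) (i : ℕ) : ℝ :=
  (-1 : ℝ) ^ (Finset.univ.filter fun a : Fin n => (a : ℕ) + 1 < i ∧ X a = (0, 0)).card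

/-- First coordinate direction. -/
def dir1 : Pt := EuclideanSpace.single 0 1

/-- Second coordinate direction. -/
def dir2 : Pt := EuclideanSpace.single 1 1

/-- Partial derivative (within `T`) of `f` in the direction `v`. -/
def pdW (T : Set Pt) (v : Pt) (f : Pt → ℝ) : Pt → ℝ := fun x => fderivWithin ℝ f T x v

/-- Sup of `|g|` over `T`. -/
def supAbs (T : Set Pt) (g : Pt → ℝ) : ℝ := ⨆ x ∈ T, |g x|

/-- The norm `‖f‖_{C²(T)}`: the maximum over all partial derivatives of order at most 2
of the sup norm on `T`. -/
def c2Norm (T : Set Pt) (f : Pt → ℝ) : ℝ :=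
  max (supAbs T f)
    (max (max (supAbs T (pdW T dir1 f)) (supAbs T (pdW T dir2 f)))
      (max (supAbs T (pdW T dir1 (pdW T dir1 f)))
        (max (supAbs T (pdW T dir2 (pdW T dir1 f)))
          (supAbs T (pdW T dir2 (pdW T dir2 f))))))

/-- The `n`-th discretized function `F_n` of `f` (with `X` given by its rows). -/
def discF (v : Pt × Pt × Pt) {n : ℕ} (f : Pt → ℝ) (X : Fin n → F2 × F2) : ℝ :=
  (volume (subTri v (List.ofFn X))).toReal⁻¹ * ∫ y in subTri v (List.ofFn X), f y

/-- The `l`-th dyadic digit of `h`. -/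
def digit (h l : ℕ) : F2 := if Nat.testBit h l then 1 else 0

/-- The weight `μ₁(k)` of a column vector: the largest (1-indexed) position of a
nonzero entry, and `0` for the zero vector. -/
def mu1 {n : ℕ} (k : Fin n → F2) : ℕ :=
  (Finset.univ.filter fun i : Fin n => k i ≠ 0).sup fun i => (i : ℕ) + 1

/-- The weight `v(K) = max (μ₁(k₁), μ₁(k₂))` of `K` (given by its rows). -/
def vK {n : ℕ} (K : Fin n → F2 × F2) : ℕ :=
  max (mu1 fun i => (K i).1) (mu1 fun i => (K i).2)

/-- Entry `(i, j)` (0-indexed row `i`) of the point `X(h)` of the digital sequence with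
generating matrices `Cm 0`, `Cm 1` (0-indexed). -/
def Xent (Cm : Fin 2 → ℕ → ℕ → F2) (h i : ℕ) (j : Fin 2) : F2 :=
  ∑ l ∈ Finset.range (h + 1), Cm j i l * digit h l

/-- Row `i` (0-indexed) of the point `X(h)` of the digital sequence. -/
def XrowS (Cm : Fin 2 → ℕ → ℕ → F2) (h i : ℕ) : F2 × F2 :=
  (Xent Cm h i 0, Xent Cm h i 1)

/-- `ν(h)`: the number of initial rows of `X(h)` after which all rows vanish. -/
def nuF (Cm : Fin 2 → ℕ → ℕ → F2) (h : ℕ) : ℕ :=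
  sInf {q | ∀ i, q ≤ i → XrowS Cm h i = (0, 0)}

/-- The `h`-th point of the sequence `S_T` in the triangle with vertex triple `v`. -/
def seqPt (v : Pt × Pt × Pt) (Cm : Fin 2 → ℕ → ℕ → F2) (h : ℕ) : Pt :=
  ctr v (List.ofFn fun i : Fin (nuF Cm h) => XrowS Cm h (i : ℕ))

/-- Row `i` of the digital-net point `X(h)` for generating matrices `C1 C2 ∈ 𝔽₂^{n×m}`. -/
def XnetRow {n m : ℕ} (C1 C2 : Matrix (Fin n) (Fin m) F2) (h : ℕ) (i : Fin n) : F2 × F2 :=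
  (∑ l : Fin m, C1 i l * digit h (l : ℕ), ∑ l : Fin m, C2 i l * digit h (l : ℕ))

/-- The Walsh function `wal_K(X)` (for `K`, `X` given by their rows). -/
def walR {n : ℕ} (K X : Fin n → F2 × F2) : ℝ :=
  (-1 : ℝ) ^ (∑ i : Fin n, ((K i).1 * (X i).1 + (K i).2 * (X i).2)).val

/-- The `K`-th Walsh coefficient of `F : 𝔽₂^{n×2} → ℝ`. -/
def fhat {n : ℕ} (F : (Fin n → F2 × F2) → ℝ) (K : Fin n → F2 × F2) : ℝ :=
  ((4:ℝ) ^ n)⁻¹ * ∑ X : Fin n → F2 × F2, F X * walR K X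

/-- The vector `τ(κ, κ')`. -/
def tau (e : F2 × F2 → Pt) (κ κ' : F2 × F2) : Pt :=
  if κ' ≠ (0, 0) ∧ κ' ≠ κ then e (κ + κ') - e κ' else e (κ + κ') + e κ'

/-- The point shift `y ⊕_i κ` on `T^{(n)}(X)` (with `i : Fin n` the 0-indexed row,
corresponding to the 1-indexed row `i+1` of the paper). -/
def ptShift (e : F2 × F2 → Pt) {n : ℕ} (X : Fin n → F2 × F2) (i : Fin n)
    (κ : F2 × F2) (y : Pt) : Pt :=
  if X i ≠ (0, 0) ∧ X i ≠ κ then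
    y + (eta X ((i : ℕ) + 1) / 2 ^ ((i : ℕ) + 1)) • tau e κ (X i)
  else
    (2:ℝ) • ctr (e (1, 0), e (0, 1), e (1, 1)) ((List.ofFn X).take (i : ℕ)) - y +
      (eta X ((i : ℕ) + 1) / 2 ^ ((i : ℕ) + 1)) • tau e κ (X i)

/-- The map `σ : 𝔽₂² → 𝔽₂²`. -/
def sigF : F2 × F2 → F2 × F2 := fun κ =>
  if κ = (0, 0) then (1, 1) else if κ = (1, 1) then (0, 1) else κ

/-- The two-element set `P(κ) = {p₁(κ), p₂(κ)}`. -/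
def pSet (κ : F2 × F2) : Finset (F2 × F2) :=
  if κ = (0, 0) then {(0, 0), (1, 1)} else if κ = (0, 1) then {(1, 1), (1, 0)}
  else if κ = (1, 0) then {(1, 1), (0, 1)} else {(1, 0), (1, 1)}

/-- The one-row Walsh function `wal_κ(ξ)`. -/
def walRow (κ ξ : F2 × F2) : ℝ := (-1 : ℝ) ^ ((κ.1 * ξ.1 + κ.2 * ξ.2 : F2)).val

/-- The `i`-th dyadic difference `d_K^{(i)} F` (with `i : Fin n` 0-indexed, corresponding
to the 1-indexed index `i+1` of the paper). -/
def dd {n : ℕ} (K : Fin n → F2 × F2) (i : Fin n) (F : (Fin n → F2 × F2) → ℝ) :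
    (Fin n → F2 × F2) → ℝ :=
  fun X => F (Function.update X i (X i + sigF (K i))) + walRow (K i) (sigF (K i)) * F X

/-- The subset `R_w(K) ⊆ 𝔽₂^{n×2}` (here `w : ℕ` is the 1-indexed paper index,
`0 ≤ w ≤ v(K)-1`). -/
def Rset {n : ℕ} (K : Fin n → F2 × F2) (w : ℕ) : Finset (Fin n → F2 × F2) :=
  Finset.univ.filter fun X =>
    (∀ i : Fin n, w ≤ (i : ℕ) → (i : ℕ) + 1 < vK K → X i ∉ pSet (K i)) ∧
    (w = 0 ∨ ∃ j : Fin n, (j : ℕ) + 1 = w ∧ X j ∈ pSet (K j))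

/-- The Walsh coefficient of `F` on the subset `R_w(K)`. -/
def rwHat {n : ℕ} (F : (Fin n → F2 × F2) → ℝ) (K : Fin n → F2 × F2) (w : ℕ) : ℝ :=
  ((4:ℝ) ^ n)⁻¹ * ∑ X ∈ Rset K w, F X * walR K X

lemma neg_one_pow_val_add (a b : F2) :
    (-1 : ℝ) ^ (a + b).val = (-1) ^ a.val * (-1) ^ b.val := by
  rw [← pow_add, neg_one_pow_eq_pow_mod_two (n := a.val + b.val), ZMod.val_add]

lemma walRow_mul_self (κ ξ : F2 × F2) : walRow κ ξ * walRow κ ξ = 1 := by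
  rw [walRow, ← mul_pow]
  norm_num

lemma walRow_sigF_of_ne_zero {κ : F2 × F2} (hκ : κ ≠ 0) :
    walRow κ (sigF κ) = -1 := by
  have h : ∀ κ : F2 × F2, κ ≠ 0 → κ.1 * (sigF κ).1 + κ.2 * (sigF κ).2 = 1 := by
    unfold sigF
    decide
  rw [walRow, h κ hκ, ZMod.val_one, pow_one]

lemma add_sigF_mem_pSet_iff (κ ξ : F2 × F2) : ξ + sigF κ ∈ pSet κ ↔ ξ ∈ pSet κ := by
  have h : ∀ κ ξ : F2 × F2, ξ + sigF κ ∈ pSet κ ↔ ξ ∈ pSet κ := by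
    unfold sigF pSet
    decide
  exact h κ ξ

lemma add_self_eq_zero_F2 (s : F2 × F2) : s + s = 0 :=
  Prod.ext (CharTwo.add_self_eq_zero _) (CharTwo.add_self_eq_zero _)

lemma walR_update_add {n : ℕ} (K X : Fin n → F2 × F2) (i : Fin n) (s : F2 × F2) :
    walR K (Function.update X i (X i + s)) = walRow (K i) s * walR K X := by
  have h : ∑ j, ((K j).1 * (Function.update X i (X i + s) j).1 +
        (K j).2 * (Function.update X i (X i + s) j).2) =
      ((K i).1 * s.1 + (K i).2 * s.2) + ∑ j, ((K j).1 * (X j).1 + (K j).2 * (X j).2) := by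
    rw [← Finset.add_sum_erase _ _ (Finset.mem_univ i),
      ← Finset.add_sum_erase (a := i) _ (fun j => (K j).1 * (X j).1 + (K j).2 * (X j).2)
        (Finset.mem_univ i),
      Finset.sum_congr rfl (g := fun j => (K j).1 * (X j).1 + (K j).2 * (X j).2)
        fun j hj => by rw [Function.update_of_ne (Finset.ne_of_mem_erase hj)]]
    simp only [Function.update_self, Prod.fst_add, Prod.snd_add]
    ring
  rw [walR, h, neg_one_pow_val_add, walRow, walR]

/-- On a set of points stable under the shift of row `i` by `σ(κ_i)`, the `i`-th dyadic
difference multiplies the Walsh sum by `2 wal_{κ_i}(σ(κ_i))`. -/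
lemma sum_dd_mul_walR {n : ℕ} (K : Fin n → F2 × F2) (i : Fin n)
    (R : Finset (Fin n → F2 × F2))
    (hR : ∀ X ∈ R, Function.update X i (X i + sigF (K i)) ∈ R)
    (F : (Fin n → F2 × F2) → ℝ) :
    ∑ X ∈ R, dd K i F X * walR K X =
      2 * walRow (K i) (sigF (K i)) * ∑ X ∈ R, F X * walR K X := by
  have hinv : ∀ X : Fin n → F2 × F2, Function.update (Function.update X i (X i + sigF (K i))) i
      (Function.update X i (X i + sigF (K i)) i + sigF (K i)) = X := fun X => by
    simp [add_assoc, add_self_eq_zero_F2]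
  have hshift : ∑ X ∈ R, F (Function.update X i (X i + sigF (K i))) * walR K X =
      walRow (K i) (sigF (K i)) * ∑ X ∈ R, F X * walR K X := by
    rw [Finset.mul_sum]
    refine Finset.sum_bij' (fun X _ => Function.update X i (X i + sigF (K i)))
      (fun X _ => Function.update X i (X i + sigF (K i))) hR hR
      (fun X _ => hinv X) (fun X _ => hinv X) fun X _ => ?_
    rw [walR_update_add]
    linear_combination (-F (Function.update X i (X i + sigF (K i))) * walR K X) *
      walRow_mul_self (K i) (sigF (K i))
  simp only [dd, add_mul, Finset.sum_add_distrib, mul_assoc, ← Finset.mul_sum]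
  rw [hshift]
  ring

lemma ne_zero_of_add_one_eq_vK {n : ℕ} {K : Fin n → F2 × F2} {i : Fin n}
    (hi : (i : ℕ) + 1 = vK K) : K i ≠ 0 := by
  intro h0
  have hlt : ∀ j : Fin n, K j ≠ 0 → (j : ℕ) + 1 ≤ vK K → (j : ℕ) + 1 ≤ i := by
    intro j hj hle
    have hne : (j : ℕ) ≠ i := fun h => hj (Fin.ext h ▸ h0)
    omega
  have h1 : mu1 (fun j => (K j).1) ≤ i := Finset.sup_le fun j hj =>
    hlt j (fun h => (Finset.mem_filter.1 hj).2 (by simp [h]))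
      ((Finset.le_sup (f := fun j : Fin n => (j : ℕ) + 1) hj).trans (le_max_left _ _))
  have h2 : mu1 (fun j => (K j).2) ≤ i := Finset.sup_le fun j hj =>
    hlt j (fun h => (Finset.mem_filter.1 hj).2 (by simp [h]))
      ((Finset.le_sup (f := fun j : Fin n => (j : ℕ) + 1) hj).trans (le_max_right _ _))
  have h3 : vK K ≤ i := max_le h1 h2
  omega

lemma update_add_sigF_mem_Rset {n : ℕ} {K X : Fin n → F2 × F2} {w : ℕ} (i : Fin n)
    (hX : X ∈ Rset K w) : Function.update X i (X i + sigF (K i)) ∈ Rset K w := by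
  have h : ∀ j, Function.update X i (X i + sigF (K i)) j ∈ pSet (K j) ↔ X j ∈ pSet (K j) := by
    intro j
    rcases eq_or_ne j i with rfl | hj
    · rw [Function.update_self, add_sigF_mem_pSet_iff]
    · rw [Function.update_of_ne hj]
  simpa only [Rset, Finset.mem_filter, Finset.mem_univ, true_and, h] using hX

/-- Lemma 7, part 3. For `1 ≤ w ≤ v(K) - 1`, the Walsh coefficient of
`F` on `R_w(K)` equals `-(1/4) wal_{κ_w}(σ(κ_w))` times that of the double dyadic
difference `d_K^{(w)} d_K^{(v(K))} F`. (Here `iv, iw : Fin n` are the 0-indexed rows with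
`(iv : ℕ) + 1 = v(K)` and `w = (iw : ℕ) + 1`.) -/
theorem statement17 {n : ℕ} (F : (Fin n → F2 × F2) → ℝ) (K : Fin n → F2 × F2)
    (hK : K ≠ 0) (iv iw : Fin n) (hiv : (iv : ℕ) + 1 = vK K)
    (hiw : (iw : ℕ) + 1 < vK K) :
    rwHat F K ((iw : ℕ) + 1) =
      -(1 / 4) * walRow (K iw) (sigF (K iw)) *
        rwHat (dd K iw (dd K iv F)) K ((iw : ℕ) + 1) := by
  rw [rwHat, rwHat, sum_dd_mul_walR K iw _ fun X hX => update_add_sigF_mem_Rset iw hX,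
    sum_dd_mul_walR K iv _ fun X hX => update_add_sigF_mem_Rset iv hX,
    walRow_sigF_of_ne_zero (ne_zero_of_add_one_eq_vK hiv)]
  linear_combination (-((4 : ℝ) ^ n)⁻¹ * ∑ X ∈ Rset K ((iw : ℕ) + 1), F X * walR K X) *
    walRow_mul_self (K iw) (sigF (K iw))
end
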